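/- Let r₁, r₂ : ℕ → ℝ^d be families of rays and s₁,...,s_k : ℕ → ℝ^d families of points, all with coordinates given by rational functions of n. For each pairwise comparison arising in the convex hull computation (signed distances of points s_i(n) to hyperplanes spanned by subsets of the points and rays), the comparisons are between rational functions of n, and hence their truth values stabilize for n sufficiently large. Consequently there exist N and a fixed subset J ⊆ {1,...,k} such that for all n ≥ N, the vertex set of the convex hull of {s₁(n),...,s_k(n)} + cone(r₁(n), r₂(n)) is exactly {s_j(n) : j ∈ J}. -/

import Mathlib

/-- `f` eventually agrees with a quotient of real polynomials with eventually
nonvanishing denominator. -/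
def IsRatFunc (f : ℕ → ℝ) : Prop :=
  ∃ p q : Polynomial ℝ, ∃ N : ℕ, ∀ n ≥ N,
    q.eval (n : ℝ) ≠ 0 ∧ f n = p.eval (n : ℝ) / q.eval (n : ℝ)

open Filter in
/-- Eventually constant truth value. -/
def EvConst (P : ℕ → Prop) : Prop := (∀ᶠ n in atTop, P n) ∨ (∀ᶠ n in atTop, ¬ P n)

open Filter

theorem EvConst.congr' {P Q : ℕ → Prop} (h : EvConst P) (e : ∀ᶠ n in atTop, P n ↔ Q n) :
    EvConst Q := by
  rcases h with h | h
  · left; filter_upwards [h, e] with n h1 h2 using h2.1 h1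
  · right; filter_upwards [h, e] with n h1 h2 using fun h => h1 (h2.2 h)

theorem EvConst.not' {P : ℕ → Prop} (h : EvConst P) : EvConst (fun n => ¬ P n) := by
  rcases h with h | h
  · right; filter_upwards [h] with n h1 using not_not.2 h1
  · left; exact h

theorem EvConst.and' {P Q : ℕ → Prop} (h : EvConst P) (h' : EvConst Q) :
    EvConst (fun n => P n ∧ Q n) := by
  rcases h with h | h
  · rcases h' with h' | h'
    · left; exact h.and h'
    · right; filter_upwards [h'] with n h1 using fun h => h1 h.2
  · right; filter_upwards [h] with n h1 using fun h => h1 h.1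

theorem EvConst.all {I : Type} [Finite I] {P : I → ℕ → Prop} (h : ∀ i, EvConst (P i)) :
    EvConst (fun n => ∀ i, P i n) := by
  by_cases H : ∀ i, ∀ᶠ n in atTop, P i n
  · left; exact eventually_all.2 H
  · rw [not_forall] at H
    obtain ⟨i, hi⟩ := H
    right
    rcases h i with h | h
    · exact absurd h hi
    · filter_upwards [h] with n hn using fun h => hn (h i)

theorem EvConst.ex {I : Type} [Finite I] {P : I → ℕ → Prop} (h : ∀ i, EvConst (P i)) :
    EvConst (fun n => ∃ i, P i n) := by
  refine (EvConst.all (fun i => (h i).not')).not'.congr' (Eventually.of_forall fun n => ?_)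
  push Not; rfl

theorem poly_sign (p : Polynomial ℝ) :
    (∀ᶠ n : ℕ in atTop, 0 < p.eval (n : ℝ)) ∨ (∀ᶠ n : ℕ in atTop, p.eval (n : ℝ) = 0) ∨
      (∀ᶠ n : ℕ in atTop, p.eval (n : ℝ) < 0) := by
  by_cases hd : 0 < p.degree
  · rcases le_total 0 p.leadingCoeff with h | h
    · left
      exact ((p.tendsto_atTop_of_leadingCoeff_nonneg hd h).comp
        tendsto_natCast_atTop_atTop).eventually (eventually_gt_atTop 0)
    · right; right
      exact ((p.tendsto_atBot_of_leadingCoeff_nonpos hd h).comp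
        tendsto_natCast_atTop_atTop).eventually (eventually_lt_atBot 0)
  · rw [Polynomial.eq_C_of_degree_le_zero (not_lt.1 hd)]
    simp only [Polynomial.eval_C]
    rcases lt_trichotomy 0 (p.coeff 0) with h | h | h
    · left; exact Eventually.of_forall fun _ => h
    · right; left; exact Eventually.of_forall fun _ => h.symm
    · right; right; exact Eventually.of_forall fun _ => h

theorem IsRatFunc.sign {f : ℕ → ℝ} (hf : IsRatFunc f) :
    (∀ᶠ n in atTop, 0 < f n) ∨ (∀ᶠ n in atTop, f n = 0) ∨ (∀ᶠ n in atTop, f n < 0) := by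
  obtain ⟨p, q, N, h⟩ := hf
  have key : ∀ᶠ n : ℕ in atTop, 0 < q.eval (n:ℝ) ^ 2 ∧
      (p * q).eval (n:ℝ) = f n * q.eval (n:ℝ) ^ 2 := by
    filter_upwards [eventually_ge_atTop N] with n hn
    obtain ⟨h1, h2⟩ := h n hn
    refine ⟨by positivity, ?_⟩
    rw [h2, Polynomial.eval_mul]; field_simp
  rcases poly_sign (p * q) with H | H | H
  · left; filter_upwards [H, key] with n h1 h2
    rw [h2.2] at h1; exact (pos_iff_pos_of_mul_pos h1).2 h2.1
  · right; left; filter_upwards [H, key] with n h1 h2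
    rw [h2.2] at h1; exact (mul_eq_zero.1 h1).resolve_right h2.1.ne'
  · right; right; filter_upwards [H, key] with n h1 h2
    rw [h2.2] at h1; exact (neg_iff_pos_of_mul_neg h1).2 h2.1

theorem IsRatFunc.const (c : ℝ) : IsRatFunc (fun _ => c) :=
  ⟨Polynomial.C c, 1, 0, fun n _ => by simp⟩

theorem IsRatFunc.add {f g : ℕ → ℝ} (hf : IsRatFunc f) (hg : IsRatFunc g) :
    IsRatFunc (fun n => f n + g n) := by
  obtain ⟨p, q, N, h⟩ := hf
  obtain ⟨p', q', N', h'⟩ := hg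
  refine ⟨p * q' + q * p', q * q', max N N', fun n hn => ?_⟩
  obtain ⟨h1, h2⟩ := h n (le_trans (le_max_left _ _) hn)
  obtain ⟨h1', h2'⟩ := h' n (le_trans (le_max_right _ _) hn)
  simp only [Polynomial.eval_mul, Polynomial.eval_add]
  exact ⟨mul_ne_zero h1 h1', by rw [h2, h2', div_add_div _ _ h1 h1']⟩

theorem IsRatFunc.mul {f g : ℕ → ℝ} (hf : IsRatFunc f) (hg : IsRatFunc g) :
    IsRatFunc (fun n => f n * g n) := by
  obtain ⟨p, q, N, h⟩ := hf
  obtain ⟨p', q', N', h'⟩ := hg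
  refine ⟨p * p', q * q', max N N', fun n hn => ?_⟩
  obtain ⟨h1, h2⟩ := h n (le_trans (le_max_left _ _) hn)
  obtain ⟨h1', h2'⟩ := h' n (le_trans (le_max_right _ _) hn)
  simp only [Polynomial.eval_mul]
  exact ⟨mul_ne_zero h1 h1', by rw [h2, h2', div_mul_div_comm]⟩

theorem IsRatFunc.neg {f : ℕ → ℝ} (hf : IsRatFunc f) : IsRatFunc (fun n => - f n) := by
  simpa using (IsRatFunc.const (-1)).mul hf

theorem IsRatFunc.sub {f g : ℕ → ℝ} (hf : IsRatFunc f) (hg : IsRatFunc g) :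
    IsRatFunc (fun n => f n - g n) := by
  simpa [sub_eq_add_neg] using hf.add hg.neg

theorem IsRatFunc.evNonneg {f : ℕ → ℝ} (hf : IsRatFunc f) : EvConst (fun n => 0 ≤ f n) := by
  rcases hf.sign with h | h | h
  · left; filter_upwards [h] with n hn using hn.le
  · left; filter_upwards [h] with n hn using hn.ge
  · right; filter_upwards [h] with n hn using not_le.2 hn

theorem IsRatFunc.evZero {f : ℕ → ℝ} (hf : IsRatFunc f) : EvConst (fun n => f n = 0) := by
  rcases hf.sign with h | h | h
  · right; filter_upwards [h] with n hn using hn.ne'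
  · left; exact h
  · right; filter_upwards [h] with n hn using hn.ne

/-- One-variable Fourier-Motzkin elimination. -/
theorem fm_one {I : Type} [Finite I] (a c : I → ℝ)
    (h0 : ∀ i, a i = 0 → 0 ≤ c i)
    (h1 : ∀ i j, 0 < a i → a j < 0 → 0 ≤ a i * c j - a j * c i) :
    ∃ x : ℝ, ∀ i, 0 ≤ a i * x + c i := by
  classical
  have := Fintype.ofFinite I
  by_cases hP : ∃ i, 0 < a i
  · obtain ⟨p, hp, hmax⟩ := Finset.exists_max_image (Finset.univ.filter fun i => 0 < a i)
      (fun i => - c i / a i) (by obtain ⟨i, hi⟩ := hP; exact ⟨i, by simpa using hi⟩)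
    simp only [Finset.mem_filter, Finset.mem_univ, true_and] at hp hmax
    refine ⟨- c p / a p, fun i => ?_⟩
    rcases lt_trichotomy 0 (a i) with h | h | h
    · have h2 := hmax i h
      have h3 := mul_le_mul_of_nonneg_left h2 h.le
      have h4 : a i * (- c i / a i) = - c i := by field_simp
      linarith
    · rw [← h]; have := h0 i h.symm; linarith
    · have h2 := h1 p i hp h
      have h3 : a i * (- c p / a p) + c i = (a p * c i - a i * c p) / a p := by
        field_simp; ring
      rw [h3]; positivity
  · by_cases hN : ∃ i, a i < 0
    · obtain ⟨p, hp, hmin⟩ := Finset.exists_min_image (Finset.univ.filter fun i => a i < 0)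
        (fun i => - c i / a i) (by obtain ⟨i, hi⟩ := hN; exact ⟨i, by simpa using hi⟩)
      simp only [Finset.mem_filter, Finset.mem_univ, true_and] at hp hmin
      refine ⟨- c p / a p, fun i => ?_⟩
      rcases lt_trichotomy 0 (a i) with h | h | h
      · exact absurd ⟨i, h⟩ hP
      · rw [← h]; have := h0 i h.symm; linarith
      · have h2 := hmin i h
        have h3 := mul_le_mul_of_nonpos_left h2 h.le
        have h4 : a i * (- c i / a i) = - c i := mul_div_cancel₀ _ h.ne
        linarith
    · refine ⟨0, fun i => ?_⟩
      push Not at hP hN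
      have := h0 i (le_antisymm (hP i) (hN i))
      linarith

theorem fm (m : ℕ) : ∀ (I : Type) [Finite I] (A : I → Fin m → ℕ → ℝ) (c : I → ℕ → ℝ),
    (∀ i j, IsRatFunc (A i j)) → (∀ i, IsRatFunc (c i)) →
    EvConst (fun n => ∃ x : Fin m → ℝ, ∀ i, 0 ≤ ∑ j, A i j n * x j + c i n) := by
  induction m with
  | zero =>
    intro I _ A c hA hc
    refine (EvConst.all (fun i => (hc i).evNonneg)).congr' (Eventually.of_forall fun n => ?_)
    simp
  | succ m ih =>
    intro I _ A c hA hc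
    let Z : I → Prop := fun i => ∀ᶠ n in atTop, A i 0 n = 0
    let P : I → Prop := fun i => ∀ᶠ n in atTop, 0 < A i 0 n
    let M : I → Prop := fun i => ∀ᶠ n in atTop, A i 0 n < 0
    have hsgn : ∀ᶠ n in atTop, ∀ i, (P i ∧ 0 < A i 0 n) ∨ (Z i ∧ A i 0 n = 0) ∨
        (M i ∧ A i 0 n < 0) := by
      rw [eventually_all]
      intro i
      rcases (hA i 0).sign with h | h | h
      · filter_upwards [h] with n hn using Or.inl ⟨h, hn⟩
      · filter_upwards [h] with n hn using Or.inr (Or.inl ⟨h, hn⟩)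
      · filter_upwards [h] with n hn using Or.inr (Or.inr ⟨h, hn⟩)
    have hZ : ∀ᶠ n in atTop, ∀ i : {i // Z i}, A i.1 0 n = 0 := eventually_all.2 fun i => i.2
    have hP : ∀ᶠ n in atTop, ∀ i : {i // P i}, 0 < A i.1 0 n := eventually_all.2 fun i => i.2
    have hM : ∀ᶠ n in atTop, ∀ i : {i // M i}, A i.1 0 n < 0 := eventually_all.2 fun i => i.2
    let A' : ({i // Z i} ⊕ ({i // P i} × {i // M i})) → Fin m → ℕ → ℝ := fun t j n =>
      Sum.elim (fun i => A i.1 j.succ n)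
        (fun pq => A pq.1.1 0 n * A pq.2.1 j.succ n - A pq.2.1 0 n * A pq.1.1 j.succ n) t
    let c' : ({i // Z i} ⊕ ({i // P i} × {i // M i})) → ℕ → ℝ := fun t n =>
      Sum.elim (fun i => c i.1 n)
        (fun pq => A pq.1.1 0 n * c pq.2.1 n - A pq.2.1 0 n * c pq.1.1 n) t
    have comb : ∀ (p q : I) (y : Fin m → ℝ) (n : ℕ),
        ∑ j, (A p 0 n * A q (Fin.succ j) n - A q 0 n * A p (Fin.succ j) n) * y j +
          (A p 0 n * c q n - A q 0 n * c p n) =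
        A p 0 n * (∑ j, A q (Fin.succ j) n * y j + c q n) -
          A q 0 n * (∑ j, A p (Fin.succ j) n * y j + c p n) := by
      intro p q y n
      rw [mul_add, mul_add, Finset.mul_sum, Finset.mul_sum]
      simp only [sub_mul, Finset.sum_sub_distrib, mul_assoc]
      ring
    refine (ih _ A' c' ?_ ?_).congr' ?_
    · rintro (i | ⟨p, q⟩) j
      · exact hA _ _
      · exact ((hA _ _).mul (hA _ _)).sub ((hA _ _).mul (hA _ _))
    · rintro (i | ⟨p, q⟩)
      · exact hc _
      · exact ((hA _ _).mul (hc _)).sub ((hA _ _).mul (hc _))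
    · filter_upwards [hsgn, hZ, hP, hM] with n h1 hz hp hm
      constructor
      · rintro ⟨y, hy⟩
        obtain ⟨x, hx⟩ := fm_one (fun i => A i 0 n)
          (fun i => ∑ j, A i (Fin.succ j) n * y j + c i n)
          (by
            intro i hi
            rcases h1 i with h | h | h
            · exact absurd hi h.2.ne'
            · exact hy (Sum.inl ⟨i, h.1⟩)
            · exact absurd hi h.2.ne)
          (by
            intro p q hp' hq'
            have hpp : P p := by
              rcases h1 p with h | h | h
              · exact h.1
              · linarith
              · linarith
            have hqq : M q := by
              rcases h1 q with h | h | h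
              · linarith
              · linarith
              · exact h.1
            have := hy (Sum.inr (⟨p, hpp⟩, ⟨q, hqq⟩))
            simp only [A', c', Sum.elim_inr] at this
            rwa [comb] at this)
        refine ⟨Fin.cons x y, fun i => ?_⟩
        have := hx i
        rw [Fin.sum_univ_succ]
        simp only [Fin.cons_zero, Fin.cons_succ]
        linarith
      · rintro ⟨x, hx⟩
        refine ⟨fun j => x j.succ, ?_⟩
        rintro (i | ⟨p, q⟩)
        · have := hx i.1
          rw [Fin.sum_univ_succ, hz i] at this
          simp only [A', c', Sum.elim_inl]
          linarith
        · simp only [A', c', Sum.elim_inr]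
          rw [comb]
          have e1 := hx p.1
          have e2 := hx q.1
          rw [Fin.sum_univ_succ] at e1 e2
          have := hp p
          have := hm q
          nlinarith [mul_nonneg (hp p).le e2, mul_nonneg (neg_nonneg.2 (hm q).le) e1]

theorem fm' (K : Type) [Fintype K] (I : Type) [Finite I] (A : I → K → ℕ → ℝ) (c : I → ℕ → ℝ)
    (hA : ∀ i j, IsRatFunc (A i j)) (hc : ∀ i, IsRatFunc (c i)) :
    EvConst (fun n => ∃ x : K → ℝ, ∀ i, 0 ≤ ∑ j, A i j n * x j + c i n) := by
  let e := Fintype.equivFin K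
  refine (fm _ I (fun i j => A i (e.symm j)) c (fun i j => hA _ _) hc).congr'
    (Eventually.of_forall fun n => ?_)
  constructor
  · rintro ⟨x, hx⟩
    refine ⟨x ∘ e, fun i => ?_⟩
    have := hx i
    rw [← e.sum_comp] at this
    simpa using this
  · rintro ⟨x, hx⟩
    refine ⟨x ∘ e.symm, fun i => ?_⟩
    have := hx i
    rw [← e.symm.sum_comp] at this
    simpa using this

/-- Nontrivial nonnegative relation among the vectors `g`. -/
theorem rel_evConst (K : Type) [Fintype K] (d : ℕ) (g : K → ℕ → Fin d → ℝ)
    (hg : ∀ l j, IsRatFunc (fun n => g l n j)) :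
    EvConst (fun n => ∃ l, g l n ≠ 0 ∧ ∃ w : K → ℝ, (∀ q, 0 ≤ w q) ∧ 1 ≤ w l ∧
      ∑ q, w q • g q n = 0) := by
  classical
  refine EvConst.ex fun l => EvConst.and' ?_ ?_
  · refine (EvConst.all fun j => (hg l j).evZero).not'.congr' (Eventually.of_forall fun n => ?_)
    simp [funext_iff]
  · let A : (Unit ⊕ K ⊕ Fin d ⊕ Fin d) → K → ℕ → ℝ := fun t q n =>
      match t with
      | .inl _ => if q = l then 1 else 0
      | .inr (.inl p) => if q = p then 1 else 0
      | .inr (.inr (.inl j)) => g q n j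
      | .inr (.inr (.inr j)) => - g q n j
    let c : (Unit ⊕ K ⊕ Fin d ⊕ Fin d) → ℕ → ℝ := fun t _ =>
      match t with
      | .inl _ => -1
      | .inr _ => 0
    refine (fm' K _ A c ?_ ?_).congr' (Eventually.of_forall fun n => ?_)
    · rintro (_ | p | j | j) q
      · exact IsRatFunc.const _
      · exact IsRatFunc.const _
      · exact hg _ _
      · exact (hg _ _).neg
    · rintro (_ | p)
      · exact IsRatFunc.const _
      · exact IsRatFunc.const _
    · refine exists_congr fun w => ?_
      simp only [Sum.forall, A, c, funext_iff, Finset.sum_apply, Pi.smul_apply, smul_eq_mul,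
        Pi.zero_apply]
      simp only [ite_mul, one_mul, zero_mul, Finset.sum_ite_eq', Finset.mem_univ, if_true,
        add_zero, neg_mul, Finset.sum_neg_distrib, forall_const]
      constructor
      · rintro ⟨h1, h2, h3, h4⟩
        refine ⟨h2, by linarith, fun j => ?_⟩
        have a1 := h3 j
        have a2 := h4 j
        simp only [mul_comm (w _)]
        linarith
      · rintro ⟨h1, h2, h3⟩
        simp only [mul_comm (w _)] at h3
        refine ⟨by linarith, h1, fun j => (h3 j).ge, fun j => by rw [h3 j]; simp⟩

section hull
variable {k d : ℕ} (s : Fin k → Fin d → ℝ) (r₁ r₂ : Fin d → ℝ)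

/-- The generating set. -/
def genSet : Set (Fin d → ℝ) :=
  {x : Fin d → ℝ | ∃ i : Fin k, ∃ a b : ℝ, 0 ≤ a ∧ 0 ≤ b ∧ x = s i + a • r₁ + b • r₂}

/-- The generators relative to `s i`. -/
def gens (i : Fin k) : Fin k ⊕ Bool → Fin d → ℝ
  | .inl p => s p - s i
  | .inr true => r₁
  | .inr false => r₂

theorem mem_hull_iff (x : Fin d → ℝ) : x ∈ convexHull ℝ (genSet s r₁ r₂) ↔
    ∃ (w : Fin k → ℝ) (a b : ℝ), (∀ p, 0 ≤ w p) ∧ ∑ p, w p = 1 ∧ 0 ≤ a ∧ 0 ≤ b ∧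
      x = ∑ p, w p • s p + a • r₁ + b • r₂ := by
  classical
  constructor
  · intro hx
    let T : Set (Fin d → ℝ) := {x | ∃ (w : Fin k → ℝ) (a b : ℝ), (∀ p, 0 ≤ w p) ∧
      ∑ p, w p = 1 ∧ 0 ≤ a ∧ 0 ≤ b ∧ x = ∑ p, w p • s p + a • r₁ + b • r₂}
    have hT : Convex ℝ T := by
      rintro _ ⟨w, a, b, h1, h2, h3, h4, rfl⟩ _ ⟨w', a', b', h1', h2', h3', h4', rfl⟩ t t' ht ht' htt
      refine ⟨fun p => t * w p + t' * w' p, t * a + t' * a', t * b + t' * b',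
        fun p => ?_, ?_, ?_, ?_, ?_⟩
      · have := h1 p
        have := h1' p
        positivity
      · rw [Finset.sum_add_distrib, ← Finset.mul_sum, ← Finset.mul_sum, h2, h2']; linarith
      · positivity
      · positivity
      · simp only [add_smul, mul_smul, Finset.sum_add_distrib, ← Finset.smul_sum]
        module
    refine convexHull_min ?_ hT hx
    rintro _ ⟨i, a, b, ha, hb, rfl⟩
    refine ⟨Pi.single i 1, a, b, fun p => ?_, by simp, ha, hb, ?_⟩
    · by_cases h : p = i
      · subst h; simp
      · simp [h]
    · simp [Pi.single_apply]
  · rintro ⟨w, a, b, h1, h2, h3, h4, rfl⟩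
    have : ∑ p, w p • s p + a • r₁ + b • r₂ = ∑ p, w p • (s p + a • r₁ + b • r₂) := by
      simp only [smul_add, Finset.sum_add_distrib, ← Finset.sum_smul, h2, one_smul]
    rw [this]
    exact (convex_convexHull ℝ _).sum_mem (fun p _ => h1 p) h2
      fun p _ => subset_convexHull ℝ _ ⟨p, a, b, h3, h4, rfl⟩

theorem hull_gens {i : Fin k} {x : Fin d → ℝ} (hx : x ∈ convexHull ℝ (genSet s r₁ r₂)) :
    ∃ w : Fin k ⊕ Bool → ℝ, (∀ q, 0 ≤ w q) ∧ x - s i = ∑ q, w q • gens s r₁ r₂ i q := by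
  obtain ⟨w, a, b, h1, h2, h3, h4, rfl⟩ := (mem_hull_iff s r₁ r₂ x).1 hx
  refine ⟨Sum.elim w (fun t => if t then a else b), ?_, ?_⟩
  · rintro (p | _ | _)
    · exact h1 p
    · exact h4
    · exact h3
  · simp only [Fintype.sum_sum_type, Sum.elim_inl, Sum.elim_inr, Fintype.sum_bool, gens,
      if_true, smul_sub, Finset.sum_sub_distrib, ← Finset.sum_smul, h2, one_smul]
    simp only [Bool.false_eq_true, if_false]
    abel

theorem gens_hull {i : Fin k} (w : Fin k ⊕ Bool → ℝ) (h : ∀ q, 0 ≤ w q) (h1 : ∑ q, w q ≤ 1) :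
    s i + ∑ q, w q • gens s r₁ r₂ i q ∈ convexHull ℝ (genSet s r₁ r₂) := by
  classical
  rw [mem_hull_iff]
  have h5 : ∑ p, w (.inl p) ≤ 1 := by
    rw [Fintype.sum_sum_type] at h1
    have : 0 ≤ ∑ t, w (.inr t) := Finset.sum_nonneg fun t _ => h _
    linarith
  refine ⟨fun p => w (.inl p) + (Pi.single i (1 - ∑ p, w (.inl p)) : Fin k → ℝ) p,
    w (.inr true), w (.inr false), fun p => ?_, ?_, h _, h _, ?_⟩
  · have := h (.inl p)
    by_cases e : p = i
    · subst e; simp only [Pi.single_eq_same]; linarith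
    · simpa [e] using this
  · rw [Finset.sum_add_distrib]; simp
  · simp only [Fintype.sum_sum_type, Fintype.sum_bool, gens, smul_sub, Finset.sum_sub_distrib,
      ← Finset.sum_smul, add_smul, Finset.sum_add_distrib]
    have : ∑ p, (Pi.single i (1 - ∑ p, w (.inl p)) : Fin k → ℝ) p • s p
        = (1 - ∑ p, w (.inl p)) • s i := by
      simp [Pi.single_apply]
    rw [this]
    module

theorem not_extreme_iff (i : Fin k) :
    s i ∉ Set.extremePoints ℝ (convexHull ℝ (genSet s r₁ r₂)) ↔
    ∃ l, gens s r₁ r₂ i l ≠ 0 ∧ ∃ w : Fin k ⊕ Bool → ℝ, (∀ q, 0 ≤ w q) ∧ 1 ≤ w l ∧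
      ∑ q, w q • gens s r₁ r₂ i q = 0 := by
  classical
  have hmem : s i ∈ convexHull ℝ (genSet s r₁ r₂) :=
    subset_convexHull ℝ _ ⟨i, 0, 0, le_rfl, le_rfl, by simp⟩
  constructor
  · intro h
    by_contra hc
    apply h
    rw [mem_extremePoints]
    refine ⟨hmem, ?_⟩
    have key : ∀ x ∈ convexHull ℝ (genSet s r₁ r₂), ∀ y ∈ convexHull ℝ (genSet s r₁ r₂),
        s i ∈ openSegment ℝ x y → x = s i := by
      intro x hx y hy ⟨t, t', ht, ht', htt, he⟩
      by_contra hne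
      obtain ⟨w, hw, hwx⟩ := hull_gens s r₁ r₂ (i := i) hx
      obtain ⟨w', hw', hwy⟩ := hull_gens s r₁ r₂ (i := i) hy
      have hz : x - s i ≠ 0 := sub_ne_zero.2 hne
      rw [hwx] at hz
      obtain ⟨l, -, hl⟩ := Finset.exists_ne_zero_of_sum_ne_zero hz
      have hl2 : gens s r₁ r₂ i l ≠ 0 := fun e => hl (by simp [e])
      have hl1 : 0 < w l := lt_of_le_of_ne (hw l) (fun e => hl (by simp [← e]))
      refine hc ⟨l, hl2, fun q => (t * w l)⁻¹ * (t * w q + t' * w' q), fun q => ?_, ?_, ?_⟩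
      · have := hw q
        have := hw' q
        positivity
      · have := hw' l
        beta_reduce
        rw [mul_add, inv_mul_cancel₀ (by positivity)]
        have : 0 ≤ (t * w l)⁻¹ * (t' * w' l) := by positivity
        linarith
      · simp only [mul_smul, add_smul, Finset.sum_add_distrib, ← Finset.smul_sum]
        rw [← hwx, ← hwy]
        have : t • (x - s i) + t' • (y - s i) = 0 := by
          have e : t • (x - s i) + t' • (y - s i) = (t • x + t' • y) - (t + t') • s i := by module
          rw [e, he, htt, one_smul, sub_self]
        rw [this, smul_zero]
    intro x hx y hy hxy
    exact ⟨key x hx y hy hxy, key y hy x hx (by rwa [openSegment_symm])⟩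
  · rintro ⟨l, hl, w, hw, hwl, hsum⟩ hext
    rw [mem_extremePoints] at hext
    set W := ∑ q, w q with hW
    have hW1 : 1 ≤ W := hwl.trans (Finset.single_le_sum (fun q _ => hw q) (Finset.mem_univ l))
    set ε := W⁻¹ with hε
    have hε0 : 0 < ε := by positivity
    have hε1 : ε ≤ 1 := inv_le_one_of_one_le₀ hW1
    have m1 := gens_hull s r₁ r₂ (i := i) (Pi.single l ε)
      (fun q => by
        by_cases e : q = l
        · subst e; simpa using hε0.le
        · simp [e]) (by simpa using hε1)
    have m2 := gens_hull s r₁ r₂ (i := i) (fun q => ε * (w q - (Pi.single l 1 : _ → ℝ) q))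
      (fun q => by
        apply mul_nonneg hε0.le
        by_cases e : q = l
        · subst e; simpa using hwl
        · simpa [e] using hw q)
      (by
        rw [← Finset.mul_sum, Finset.sum_sub_distrib]
        simp only [Finset.sum_pi_single', Finset.mem_univ, if_true, ← hW]
        have : ε * W = 1 := inv_mul_cancel₀ (by positivity)
        nlinarith)
    have e1 : ∑ q, (Pi.single l ε : _ → ℝ) q • gens s r₁ r₂ i q = ε • gens s r₁ r₂ i l := by
      simp [Pi.single_apply]
    have e2 : ∑ q, (ε * (w q - (Pi.single l 1 : _ → ℝ) q)) • gens s r₁ r₂ i q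
        = - (ε • gens s r₁ r₂ i l) := by
      simp only [mul_smul, ← Finset.smul_sum, sub_smul, Finset.sum_sub_distrib, hsum]
      simp [Pi.single_apply]
    rw [e1] at m1
    rw [e2] at m2
    have := (hext.2 _ m1 _ m2 ⟨1/2, 1/2, by norm_num, by norm_num, by norm_num, by module⟩).1
    rw [add_eq_left, smul_eq_zero] at this
    exact this.elim hε0.ne' hl

theorem extreme_mem {x : Fin d → ℝ}
    (hx : x ∈ Set.extremePoints ℝ (convexHull ℝ (genSet s r₁ r₂))) : ∃ i, x = s i := by
  obtain ⟨i, a, b, ha, hb, rfl⟩ := extremePoints_convexHull_subset hx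
  refine ⟨i, ?_⟩
  rw [mem_extremePoints] at hx
  have m1 : s i ∈ convexHull ℝ (genSet s r₁ r₂) :=
    subset_convexHull ℝ _ ⟨i, 0, 0, le_rfl, le_rfl, by simp⟩
  have m2 : s i + (2 * a) • r₁ + (2 * b) • r₂ ∈ convexHull ℝ (genSet s r₁ r₂) :=
    subset_convexHull ℝ _ ⟨i, 2 * a, 2 * b, by positivity, by positivity, rfl⟩
  exact (hx.2 _ m1 _ m2 ⟨1/2, 1/2, by norm_num, by norm_num, by norm_num, by module⟩).1.symm

end hull


/-- The combinatorics of the convex hull of a family of points plus a cone on two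
rays, all with rational-function coordinates, eventually stabilizes: there are `N`
and a fixed index set `J` such that for all `n ≥ N`, the vertex set (extreme points)
of `conv({s₁(n),…,s_k(n)} + cone(r₁(n), r₂(n)))` is exactly `{s_j(n) : j ∈ J}`. -/
theorem stmt_18 (d k : ℕ) (s : Fin k → ℕ → Fin d → ℝ) (r₁ r₂ : ℕ → Fin d → ℝ)
    (hs : ∀ i j, IsRatFunc (fun n => s i n j))
    (hr₁ : ∀ j, IsRatFunc (fun n => r₁ n j))
    (hr₂ : ∀ j, IsRatFunc (fun n => r₂ n j)) :
    ∃ N : ℕ, ∃ J : Finset (Fin k), ∀ n ≥ N,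
      Set.extremePoints ℝ (convexHull ℝ
        {x : Fin d → ℝ | ∃ i : Fin k, ∃ a b : ℝ, 0 ≤ a ∧ 0 ≤ b ∧
          x = s i n + a • r₁ n + b • r₂ n})
      = {x : Fin d → ℝ | ∃ j ∈ J, x = s j n} := by
  classical
  have H : ∀ i, EvConst (fun n => s i n ∈ Set.extremePoints ℝ
      (convexHull ℝ (genSet (fun p => s p n) (r₁ n) (r₂ n)))) := by
    intro i
    refine (rel_evConst (Fin k ⊕ Bool) d
      (fun q n => gens (fun p => s p n) (r₁ n) (r₂ n) i q) ?_).not'.congr'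
      (Filter.Eventually.of_forall fun n => ?_)
    · rintro (p | _ | _) j
      · exact (hs p j).sub (hs i j)
      · exact hr₂ j
      · exact hr₁ j
    · exact (not_congr (not_extreme_iff (fun p => s p n) (r₁ n) (r₂ n) i).symm).trans not_not
  let J : Finset (Fin k) := Finset.univ.filter fun i => ∀ᶠ n in Filter.atTop,
    s i n ∈ Set.extremePoints ℝ (convexHull ℝ (genSet (fun p => s p n) (r₁ n) (r₂ n)))
  have hJ : ∀ᶠ n in Filter.atTop, ∀ i, i ∈ J ↔
      s i n ∈ Set.extremePoints ℝ (convexHull ℝ (genSet (fun p => s p n) (r₁ n) (r₂ n))) := by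
    rw [Filter.eventually_all]
    intro i
    rcases H i with h | h
    · filter_upwards [h] with n hn
      simp only [J, Finset.mem_filter, Finset.mem_univ, true_and]
      exact iff_of_true h hn
    · filter_upwards [h] with n hn
      simp only [J, Finset.mem_filter, Finset.mem_univ, true_and]
      refine iff_of_false (fun h' => ?_) hn
      obtain ⟨m, hm⟩ := (h.and h').exists
      exact hm.1 hm.2
  obtain ⟨N, hN⟩ := Filter.eventually_atTop.1 hJ
  refine ⟨N, J, fun n hn => ?_⟩
  change Set.extremePoints ℝ (convexHull ℝ (genSet (fun p => s p n) (r₁ n) (r₂ n))) = _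
  ext x
  constructor
  · intro hx
    obtain ⟨i, rfl⟩ := extreme_mem _ _ _ hx
    exact ⟨i, (hN n hn i).2 hx, rfl⟩
  · rintro ⟨j, hj, rfl⟩
    exact (hN n hn j).1 hj
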